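/- Suppose U = ℝⁿ, f satisfies (f0)–(f2) and g ∈ C¹_b(ℝⁿ). Set δ = min{1/(2μN), 1} with N = sup_{x∈ℝⁿ} |D_p H(T,x,Dg(x))|, and let ε₀ = ε(ρ₀). Then for any δ₁ ∈ (0,δ], any ε ∈ (0,ε₀], any x ∈ cl(Ω) and any γ ∈ 𝒳_{ε,δ₁}[x]: if γ(T) ∉ cl(Ω), then ⟨γ̇(T), Db_Ω(γ(T))⟩ ≤ 0. -/

import Mathlib

open MeasureTheory Set Metric Filter
open scoped Topology NNReal RealInnerProductSpace

noncomputable section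

abbrev EucSp (n : ℕ) := EuclideanSpace ℝ (Fin n)

/-- Distance from the closure of `Ω`. -/
def dOm {n : ℕ} (Ω : Set (EucSp n)) (x : EucSp n) : ℝ := Metric.infDist x (closure Ω)

/-- Oriented boundary distance `b_Ω = d_Ω - d_{Ω^c}`. -/
def bOm {n : ℕ} (Ω : Set (EucSp n)) (x : EucSp n) : ℝ := dOm Ω x - Metric.infDist x Ωᶜ

/-- Gradient of the oriented boundary distance. -/
def DbOm {n : ℕ} (Ω : Set (EucSp n)) (x : EucSp n) : EucSp n := gradient (bOm Ω) x

/-- The tube `Σ_ρ = ∪_{y ∈ ∂Ω} B(y, ρ)`. -/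
def tubeNbhd {n : ℕ} (Ω : Set (EucSp n)) (ρ : ℝ) : Set (EucSp n) :=
  ⋃ y ∈ frontier Ω, Metric.ball y ρ

/-- `Ω` has "C² boundary data at scale ρ₀": `b_Ω` is C² with bounded derivatives on the tube. -/
def C2Bdry {n : ℕ} (Ω : Set (EucSp n)) (ρ₀ : ℝ) : Prop :=
  0 < ρ₀ ∧ ContDiffOn ℝ 2 (bOm Ω) (tubeNbhd Ω ρ₀) ∧
    ∃ C : ℝ, ∀ x ∈ tubeNbhd Ω ρ₀,
      ‖DbOm Ω x‖ ≤ C ∧ ‖fderiv ℝ (fun y => DbOm Ω y) x‖ ≤ C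

/-- Absolute continuity on `[0,T]` via an integrable a.e. derivative and FTC. -/
def AbsCont {n : ℕ} (T : ℝ) (γ : ℝ → EucSp n) : Prop :=
  ∃ γ' : ℝ → EucSp n, IntegrableOn γ' (Icc 0 T) ∧
    ∀ t ∈ Icc 0 T, γ t = γ 0 + ∫ s in (0:ℝ)..t, γ' s

/-- State constraint: the curve stays in `cl Ω` on `[0,T]`. -/
def InCl {n : ℕ} (Ω : Set (EucSp n)) (T : ℝ) (γ : ℝ → EucSp n) : Prop :=
  ∀ t ∈ Icc 0 T, γ t ∈ closure Ω

/-- The functional `J[γ] = ∫₀ᵀ f(t,γ,γ̇) dt + g(γ(T))`. -/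
def costJ {n : ℕ} (T : ℝ) (f : ℝ → EucSp n → EucSp n → ℝ) (g : EucSp n → ℝ)
    (γ : ℝ → EucSp n) : ℝ :=
  (∫ t in (0:ℝ)..T, f t (γ t) (deriv γ t)) + g (γ T)

/-- Minimizer of the constrained problem over `Γ[x]`. -/
def IsMinCon {n : ℕ} (Ω : Set (EucSp n)) (T : ℝ) (f : ℝ → EucSp n → EucSp n → ℝ)
    (g : EucSp n → ℝ) (x : EucSp n) (γ : ℝ → EucSp n) : Prop :=
  AbsCont T γ ∧ InCl Ω T γ ∧ γ 0 = x ∧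
    ∀ σ : ℝ → EucSp n, AbsCont T σ → InCl Ω T σ → σ 0 = x →
      costJ T f g γ ≤ costJ T f g σ

/-- Penalized functional. -/
def costPen {n : ℕ} (Ω : Set (EucSp n)) (T ε δ : ℝ) (f : ℝ → EucSp n → EucSp n → ℝ)
    (g : EucSp n → ℝ) (γ : ℝ → EucSp n) : ℝ :=
  (∫ t in (0:ℝ)..T, (f t (γ t) (deriv γ t) + (1/ε) * dOm Ω (γ t)))
    + (1/δ) * dOm Ω (γ T) + g (γ T)

/-- Minimizer of the penalized problem. -/
def IsPenMin {n : ℕ} (Ω : Set (EucSp n)) (T ε δ : ℝ) (f : ℝ → EucSp n → EucSp n → ℝ)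
    (g : EucSp n → ℝ) (x : EucSp n) (γ : ℝ → EucSp n) : Prop :=
  AbsCont T γ ∧ γ 0 = x ∧
    ∀ σ : ℝ → EucSp n, AbsCont T σ → σ 0 = x →
      costPen Ω T ε δ f g γ ≤ costPen Ω T ε δ f g σ

/-- Assumptions (f0)-(f2). -/
structure FAssumptions {n : ℕ} (T : ℝ) (U : Set (EucSp n))
    (f : ℝ → EucSp n → EucSp n → ℝ)
    (Dxf Dvf : ℝ → EucSp n → EucSp n → EucSp n)
    (Dvvf Dvxf : ℝ → EucSp n → EucSp n → (EucSp n →L[ℝ] EucSp n))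
    (M μ κ : ℝ) : Prop where
  Mnonneg : 0 ≤ M
  μge : 1 ≤ μ
  κnonneg : 0 ≤ κ
  fCont : ContinuousOn (fun p : ℝ × EucSp n × EucSp n => f p.1 p.2.1 p.2.2)
    ((Icc 0 T) ×ˢ U ×ˢ (univ : Set (EucSp n)))
  hDxf : ∀ t ∈ Icc 0 T, ∀ x ∈ U, ∀ v : EucSp n,
    HasGradientAt (fun y => f t y v) (Dxf t x v) x
  hDvf : ∀ t ∈ Icc 0 T, ∀ x ∈ U, ∀ v : EucSp n,
    HasGradientAt (fun w => f t x w) (Dvf t x v) v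
  DxfCont : ContinuousOn (fun p : ℝ × EucSp n × EucSp n => Dxf p.1 p.2.1 p.2.2)
    ((Icc 0 T) ×ˢ U ×ˢ (univ : Set (EucSp n)))
  DvfCont : ContinuousOn (fun p : ℝ × EucSp n × EucSp n => Dvf p.1 p.2.1 p.2.2)
    ((Icc 0 T) ×ˢ U ×ˢ (univ : Set (EucSp n)))
  bound0 : ∀ t ∈ Icc 0 T, ∀ x ∈ U, |f t x 0| + ‖Dxf t x 0‖ + ‖Dvf t x 0‖ ≤ M
  hDvvf : ∀ t ∈ Icc 0 T, ∀ x ∈ U, ∀ v : EucSp n,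
    HasFDerivAt (fun w => Dvf t x w) (Dvvf t x v) v
  hDvxf : ∀ t ∈ Icc 0 T, ∀ x ∈ U, ∀ v : EucSp n,
    HasFDerivAt (fun y => Dvf t y v) (Dvxf t x v) x
  DvvfCont : ContinuousOn (fun p : ℝ × EucSp n × EucSp n => Dvvf p.1 p.2.1 p.2.2)
    ((Icc 0 T) ×ˢ U ×ˢ (univ : Set (EucSp n)))
  DvxfCont : ContinuousOn (fun p : ℝ × EucSp n × EucSp n => Dvxf p.1 p.2.1 p.2.2)
    ((Icc 0 T) ×ˢ U ×ˢ (univ : Set (EucSp n)))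
  vvLower : ∀ t ∈ Icc 0 T, ∀ x ∈ U, ∀ v w : EucSp n,
    (1/μ) * ‖w‖^2 ≤ ⟪Dvvf t x v w, w⟫
  vvUpper : ∀ t ∈ Icc 0 T, ∀ x ∈ U, ∀ v w : EucSp n,
    ⟪Dvvf t x v w, w⟫ ≤ μ * ‖w‖^2
  vxBound : ∀ t ∈ Icc 0 T, ∀ x ∈ U, ∀ v : EucSp n, ‖Dvxf t x v‖ ≤ μ * (1 + ‖v‖)
  tLip : ∀ t ∈ Icc 0 T, ∀ s ∈ Icc 0 T, ∀ x ∈ U, ∀ v : EucSp n,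
    |f t x v - f s x v| ≤ κ * (1 + ‖v‖^2) * |t - s|
  DvfTLip : ∀ t ∈ Icc 0 T, ∀ s ∈ Icc 0 T, ∀ x ∈ U, ∀ v : EucSp n,
    ‖Dvf t x v - Dvf s x v‖ ≤ κ * (1 + ‖v‖) * |t - s|

/-- Assumption (g1): `g ∈ C¹_b(U)` with gradient `Dg` and bound `Cg`. -/
structure GAssumptions {n : ℕ} (U : Set (EucSp n)) (g : EucSp n → ℝ)
    (Dg : EucSp n → EucSp n) (Cg : ℝ) : Prop where
  grad : ∀ x ∈ U, HasGradientAt g (Dg x) x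
  contDg : ContinuousOn Dg U
  bdd : ∀ x ∈ U, |g x| ≤ Cg ∧ ‖Dg x‖ ≤ Cg

/-- The Hamiltonian `H(t,x,p) = sup_v {-⟨p,v⟩ - f(t,x,v)}`. -/
def ham {n : ℕ} (f : ℝ → EucSp n → EucSp n → ℝ) (t : ℝ) (x p : EucSp n) : ℝ :=
  ⨆ v : EucSp n, (-⟪p, v⟫ - f t x v)

def DpH {n : ℕ} (f : ℝ → EucSp n → EucSp n → ℝ) (t : ℝ) (x p : EucSp n) : EucSp n :=
  gradient (fun q => ham f t x q) p

def DxH {n : ℕ} (f : ℝ → EucSp n → EucSp n → ℝ) (t : ℝ) (x p : EucSp n) : EucSp n :=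
  gradient (fun y => ham f t y p) x

def DppH {n : ℕ} (f : ℝ → EucSp n → EucSp n → ℝ) (t : ℝ) (x p : EucSp n) :
    EucSp n →L[ℝ] EucSp n := fderiv ℝ (fun q => DpH f t x q) p

def DpxH {n : ℕ} (f : ℝ → EucSp n → EucSp n → ℝ) (t : ℝ) (x p : EucSp n) :
    EucSp n →L[ℝ] EucSp n := fderiv ℝ (fun y => DpH f t y p) x

def DptH {n : ℕ} (f : ℝ → EucSp n → EucSp n → ℝ) (t : ℝ) (x p : EucSp n) : EucSp n :=
  deriv (fun s => DpH f s x p) t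

/-- The explicit feedback function `Λ`. -/
def LamFun {n : ℕ} (Ω : Set (EucSp n)) (f : ℝ → EucSp n → EucSp n → ℝ)
    (t : ℝ) (x p : EucSp n) : ℝ :=
  (-⟪(fderiv ℝ (fun y => DbOm Ω y) x) (DpH f t x p), DpH f t x p⟫
    - ⟪DbOm Ω x, DptH f t x p⟫
    - ⟪DbOm Ω x, DpxH f t x p (DpH f t x p)⟫
    + ⟪DbOm Ω x, DppH f t x p (DxH f t x p)⟫)
  / ⟪DbOm Ω x, DppH f t x p (DbOm Ω x)⟫

/-- `γ` is `C^{1,1}` on `[0,T]` with derivative `γd`. -/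
def IsC11On {n : ℕ} (T : ℝ) (γ γd : ℝ → EucSp n) : Prop :=
  (∀ t ∈ Icc 0 T, HasDerivWithinAt γ (γd t) (Icc 0 T) t) ∧
    ∃ K : ℝ≥0, LipschitzOnWith K γd (Icc 0 T)

section Convexity

variable {E : Type*} [NormedAddCommGroup E] [InnerProductSpace ℝ E] [CompleteSpace E]

theorem add_deriv_add_half_le_of_le_deriv2 {k k' k'' : ℝ → ℝ} {c : ℝ}
    (hk : ∀ s, HasDerivAt k (k' s) s) (hk' : ∀ s, HasDerivAt k' (k'' s) s)
    (hc : ∀ s, c ≤ k'' s) : k 0 + k' 0 + c / 2 ≤ k 1 := by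
  have h1 : ∀ s, HasDerivAt (fun s => k' s - c * s) (k'' s - c) s := fun s => by
    convert! (hk' s).sub ((hasDerivAt_id s).const_mul c) using 1
    simp
  have m1 : Monotone (fun s => k' s - c * s) :=
    monotone_of_hasDerivAt_nonneg h1 fun s => sub_nonneg.2 (hc s)
  have h2 : ∀ s, HasDerivAt (fun s => k s - k' 0 * s - c / 2 * s ^ 2)
      (k' s - k' 0 - c * s) s := fun s => by
    convert! ((hk s).sub ((hasDerivAt_id s).const_mul (k' 0))).sub
      (((hasDerivAt_id s).pow 2).const_mul (c / 2)) using 1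
    simp; ring
  have m2 : MonotoneOn (fun s => k s - k' 0 * s - c / 2 * s ^ 2) (Icc 0 1) := by
    refine monotoneOn_of_deriv_nonneg (convex_Icc 0 1)
      (fun s _ => (h2 s).continuousAt.continuousWithinAt)
      (fun s _ => (h2 s).differentiableAt.differentiableWithinAt) fun s hs => ?_
    rw [interior_Icc] at hs
    rw [(h2 s).deriv]
    have := m1 hs.1.le
    simp only [mul_zero] at this
    linarith
  have := m2 (left_mem_Icc.2 zero_le_one) (right_mem_Icc.2 zero_le_one) zero_le_one
  norm_num at this
  linarith

variable {φ : E → ℝ} {G : E → E} {B : E → E →L[ℝ] E}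

theorem HasGradientAt.hasDerivAt_comp_line {v w g : E} {s : ℝ}
    (hg : HasGradientAt φ g (v + s • w)) :
    HasDerivAt (fun s : ℝ => φ (v + s • w)) ⟪g, w⟫ s := by
  have h1 : HasDerivAt (fun s : ℝ => v + s • w) w s := by
    simpa using ((hasDerivAt_id s).smul_const w).const_add v
  simpa [Function.comp_def] using hg.hasFDerivAt.comp_hasDerivAt s h1

omit [CompleteSpace E] in
theorem hasDerivAt_inner_comp_line (hB : ∀ v, HasFDerivAt G (B v) v) (v w : E) (s : ℝ) :
    HasDerivAt (fun s : ℝ => ⟪G (v + s • w), w⟫) ⟪B (v + s • w) w, w⟫ s := by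
  have h1 : HasDerivAt (fun s : ℝ => v + s • w) w s := by
    simpa using ((hasDerivAt_id s).smul_const w).const_add v
  have := ((hB (v + s • w)).comp_hasDerivAt s h1).inner ℝ (hasDerivAt_const s w)
  simpa [Function.comp_def] using this

theorem quadratic_lower_bound (hG : ∀ v, HasGradientAt φ (G v) v)
    (hB : ∀ v, HasFDerivAt G (B v) v) {m : ℝ} (hm : ∀ v w, m * ‖w‖ ^ 2 ≤ ⟪B v w, w⟫) (v w : E) :
    φ v + ⟪G v, w⟫ + m / 2 * ‖w‖ ^ 2 ≤ φ (v + w) := by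
  have := add_deriv_add_half_le_of_le_deriv2 (fun s => (hG (v + s • w)).hasDerivAt_comp_line)
    (hasDerivAt_inner_comp_line hB v w) (fun s => hm (v + s • w) w)
  simp only [zero_smul, one_smul, add_zero] at this
  linarith

theorem quadratic_upper_bound (hG : ∀ v, HasGradientAt φ (G v) v)
    (hB : ∀ v, HasFDerivAt G (B v) v) {m : ℝ} (hm : ∀ v w, ⟪B v w, w⟫ ≤ m * ‖w‖ ^ 2) (v w : E) :
    φ (v + w) ≤ φ v + ⟪G v, w⟫ + m / 2 * ‖w‖ ^ 2 := by
  have := add_deriv_add_half_le_of_le_deriv2 (fun s => (hG (v + s • w)).hasDerivAt_comp_line.neg)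
    (fun s => (hasDerivAt_inner_comp_line hB v w s).neg)
    (fun s => neg_le_neg (hm (v + s • w) w))
  simp only [zero_smul, one_smul, add_zero, Pi.neg_apply] at this
  linarith

theorem exists_forall_add_inner_le [FiniteDimensional ℝ E] (hG : ∀ v, HasGradientAt φ (G v) v)
    {m : ℝ} (hm : 0 < m) (hφ : ∀ w, φ 0 + ⟪G 0, w⟫ + m / 2 * ‖w‖ ^ 2 ≤ φ w) (p : E) :
    ∃ v, ∀ w, φ v + ⟪p, v⟫ ≤ φ w + ⟪p, w⟫ := by
  have hc : Continuous fun w => φ w + ⟪p, w⟫ :=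
    (continuous_iff_continuousAt.2 fun v => (hG v).continuousAt).add (by fun_prop)
  refine hc.exists_forall_le' 0 ?_
  set K := ‖G 0‖ + ‖p‖ with hK
  have hfar : ∀ᶠ w : E in cocompact E, 2 * K / m ≤ ‖w‖ :=
    (tendsto_norm_cocompact_atTop (E := E)).eventually_ge_atTop _
  filter_upwards [hfar] with w hw
  have h1 := abs_le.1 (abs_real_inner_le_norm (G 0) w)
  have h2 := abs_le.1 (abs_real_inner_le_norm p w)
  rw [div_le_iff₀ hm] at hw
  have h3 := hφ w
  have h4 := norm_nonneg w
  simp only [inner_zero_right]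
  nlinarith

theorem gradient_eq_neg_of_forall_add_inner_le (hG : ∀ v, HasGradientAt φ (G v) v) {p v : E}
    (hv : ∀ w, φ v + ⟪p, v⟫ ≤ φ w + ⟪p, w⟫) : G v = -p := by
  have h1 : HasFDerivAt (fun w => φ w + ⟪p, w⟫)
      (InnerProductSpace.toDual ℝ E (G v) + innerSL ℝ p) v :=
    (hG v).hasFDerivAt.add (innerSL ℝ p).hasFDerivAt
  have hmin : IsLocalMin (fun w => φ w + ⟪p, w⟫) v := Eventually.of_forall hv
  have h2 := congrArg (fun L : E →L[ℝ] ℝ => L (G v + p)) (hmin.hasFDerivAt_eq_zero h1)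
  simp only [add_apply, InnerProductSpace.toDual_apply_apply,
    innerSL_apply_apply, ← inner_add_left, zero_apply] at h2
  exact eq_neg_of_add_eq_zero_left (inner_self_eq_zero.1 h2)

/-- The negated Legendre transform of a strongly convex function is differentiable, with gradient
given by the maximizer. -/
theorem hasGradientAt_iSup_neg_inner_sub {m : ℝ} (hm : 0 < m) {p v : E}
    (hv : ∀ w, φ v - ⟪p, w - v⟫ + m / 2 * ‖w - v‖ ^ 2 ≤ φ w) :
    HasGradientAt (fun q => ⨆ w, (-⟪q, w⟫ - φ w)) (-v) p := by
  have hub : ∀ q w, -⟪q, w⟫ - φ w ≤ -⟪q, v⟫ - φ v + 1 / (2 * m) * ‖q - p‖ ^ 2 := by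
    intro q w
    have h1 := hv w
    have h2 := abs_le.1 (abs_real_inner_le_norm (q - p) (w - v))
    have h3 : ‖q - p‖ * ‖w - v‖ ≤ 1 / (2 * m) * ‖q - p‖ ^ 2 + m / 2 * ‖w - v‖ ^ 2 := by
      have : 1 / (2 * m) * ‖q - p‖ ^ 2 + m / 2 * ‖w - v‖ ^ 2 - ‖q - p‖ * ‖w - v‖
          = 1 / (2 * m) * (‖q - p‖ - m * ‖w - v‖) ^ 2 := by field_simp; ring
      have : 0 ≤ 1 / (2 * m) * (‖q - p‖ - m * ‖w - v‖) ^ 2 := by positivity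
      linarith
    simp only [inner_sub_left, inner_sub_right] at h1 h2 ⊢
    linarith
  have hbdd : ∀ q, BddAbove (range fun w => -⟪q, w⟫ - φ w) := fun q =>
    ⟨_, forall_mem_range.2 (hub q)⟩
  have hlow : ∀ q, -⟪q, v⟫ - φ v ≤ ⨆ w, (-⟪q, w⟫ - φ w) := fun q => le_ciSup (hbdd q) v
  have hup : ∀ q, ⨆ w, (-⟪q, w⟫ - φ w) ≤ -⟪q, v⟫ - φ v + 1 / (2 * m) * ‖q - p‖ ^ 2 :=
    fun q => ciSup_le (hub q)
  have hp : ⨆ w, (-⟪p, w⟫ - φ w) = -⟪p, v⟫ - φ v :=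
    le_antisymm (by simpa using hup p) (hlow p)
  rw [hasGradientAt_iff_isLittleO]
  have hO : (fun q => (⨆ w, (-⟪q, w⟫ - φ w)) - (⨆ w, (-⟪p, w⟫ - φ w)) - ⟪-v, q - p⟫)
      =O[𝓝 p] fun q => ‖q - p‖ ^ 2 := by
    refine Asymptotics.IsBigO.of_bound (1 / (2 * m)) (Eventually.of_forall fun q => ?_)
    have h1 := hlow q
    have h2 := hup q
    have h3 : ⟪-v, q - p⟫ = -⟪q, v⟫ + ⟪p, v⟫ := by
      rw [real_inner_comm]
      simp only [inner_sub_left, inner_neg_right]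
      ring
    rw [hp, h3, Real.norm_eq_abs, norm_pow, norm_norm, abs_le]
    constructor
    · have : 0 ≤ 1 / (2 * m) * ‖q - p‖ ^ 2 := by positivity
      linarith
    · linarith
  refine hO.trans_isLittleO ?_
  have h0 : Tendsto (fun q => ‖q - p‖) (𝓝 p) (𝓝 0) := by
    have : Continuous fun q : E => ‖q - p‖ := by fun_prop
    simpa using this.tendsto p
  have := (Asymptotics.isLittleO_pow_id (𝕜 := ℝ) (n := 2) one_lt_two).comp_tendsto h0
  exact this.trans_isBigO (Asymptotics.isBigO_norm_left.2 (Asymptotics.isBigO_refl _ _))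

end Convexity

section Distance

variable {E : Type*} [NormedAddCommGroup E] [InnerProductSpace ℝ E] [FiniteDimensional ℝ E]

/-- Outside a closed set, the distance function has a unit gradient wherever it is
differentiable. -/
theorem norm_eq_one_of_hasGradientAt_infDist {C : Set E} (hC : IsClosed C) (hne : C.Nonempty)
    {y ν : E} (hy : y ∉ C) (hν : HasGradientAt (fun z => infDist z C) ν y) : ‖ν‖ = 1 := by
  refine le_antisymm ?_ ?_
  · have := hν.hasFDerivAt.le_of_lipschitz (lipschitz_infDist_pt C)
    simpa using this
  · obtain ⟨z, hz, hyz⟩ := hC.exists_infDist_eq_dist hne y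
    have hD : 0 < infDist y C := (hC.notMem_iff_infDist_pos hne).1 hy
    have hν' : HasGradientAt (fun z => infDist z C) ν (y + (0 : ℝ) • (z - y)) := by simpa using hν
    have hd := hν'.hasDerivAt_comp_line.hasDerivWithinAt (s := Ioi 0)
    rw [hasDerivWithinAt_iff_tendsto_slope' self_notMem_Ioi] at hd
    have hle : ⟪ν, z - y⟫ ≤ -infDist y C := by
      refine le_of_tendsto hd ?_
      filter_upwards [Ioo_mem_nhdsGT (zero_lt_one (α := ℝ))] with s hs
      have h1 : infDist (y + s • (z - y)) C ≤ (1 - s) * infDist y C := by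
        refine (infDist_le_dist_of_mem hz).trans (le_of_eq ?_)
        rw [hyz, dist_eq_norm, dist_eq_norm,
          show y + s • (z - y) - z = (1 - s) • (y - z) by module, norm_smul, Real.norm_eq_abs,
          abs_of_nonneg (by linarith [hs.2])]
      rw [slope_def_field, div_le_iff₀ (by linarith [hs.1])]
      simp only [zero_smul, add_zero]
      linarith
    have h2 := abs_le.1 (abs_real_inner_le_norm ν (z - y))
    have h3 : ‖z - y‖ = infDist y C := by rw [hyz, dist_comm, dist_eq_norm]
    rw [h3] at h2
    by_contra! h
    nlinarith

end Distance

theorem bOm_eventuallyEq_dOm {n : ℕ} {Ω : Set (EucSp n)} {y : EucSp n} (hy : y ∉ closure Ω) :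
    bOm Ω =ᶠ[𝓝 y] dOm Ω := by
  filter_upwards [isClosed_closure.isOpen_compl.mem_nhds hy] with z hz
  have : z ∈ Ωᶜ := fun h => hz (subset_closure h)
  simp [bOm, infDist_zero_of_mem this]

theorem norm_DbOm_eq_one {n : ℕ} {Ω : Set (EucSp n)} (hne : Ω.Nonempty) {y : EucSp n}
    (hy : y ∉ closure Ω) (hν : HasGradientAt (dOm Ω) (DbOm Ω y) y) : ‖DbOm Ω y‖ = 1 :=
  norm_eq_one_of_hasGradientAt_infDist isClosed_closure hne.closure hy hν

theorem exists_lt_dOm {n : ℕ} [Nontrivial (EucSp n)] {Ω : Set (EucSp n)}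
    (hΩ : Bornology.IsBounded Ω) (hne : Ω.Nonempty) (r : ℝ) : ∃ z, r < dOm Ω z := by
  obtain ⟨R, hR⟩ := hΩ.closure.subset_closedBall 0
  obtain ⟨z, hz⟩ := NormedSpace.exists_lt_norm ℝ (EucSp n) (r + R)
  refine ⟨z, ?_⟩
  have hle : ‖z‖ - R ≤ dOm Ω z := (le_infDist hne.closure).2 fun w hw => by
    have h1 := mem_closedBall_zero_iff.1 (hR hw)
    have h2 := norm_sub_norm_le z w
    rw [dist_eq_norm]
    linarith
  linarith

section Curves

variable {n : ℕ} {T : ℝ} {γ : ℝ → EucSp n}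

theorem AbsCont.ae_deriv_eq (hT : 0 ≤ T) {γ' : ℝ → EucSp n} (hi : IntegrableOn γ' (Icc 0 T))
    (hγ : ∀ t ∈ Icc 0 T, γ t = γ 0 + ∫ s in (0:ℝ)..t, γ' s) :
    ∀ᵐ t, t ∈ Ioc 0 T → deriv γ t = γ' t := by
  have hii : IntervalIntegrable γ' volume 0 T :=
    (intervalIntegrable_iff_integrableOn_Icc_of_le hT).2 hi
  filter_upwards [hii.ae_hasDerivAt_integral, Measure.ae_ne volume T] with t ht htT ht0
  rw [uIcc_of_le hT] at ht
  have h1 := (ht (Ioc_subset_Icc_self ht0) 0 (left_mem_Icc.2 hT)).const_add (γ 0)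
  refine (h1.congr_of_eventuallyEq ?_).deriv
  filter_upwards [Ioo_mem_nhds ht0.1 (lt_of_le_of_ne ht0.2 htT)] with s hs
  exact hγ s (Ioo_subset_Icc_self hs)

theorem absCont_iff_deriv (hT : 0 ≤ T) :
    AbsCont T γ ↔ IntervalIntegrable (deriv γ) volume 0 T ∧
      ∀ t ∈ Icc 0 T, γ t = γ 0 + ∫ s in (0:ℝ)..t, deriv γ s := by
  rw [intervalIntegrable_iff_integrableOn_Icc_of_le hT]
  refine ⟨fun ⟨γ', hi, hγ⟩ => ?_, fun h => ⟨_, h.1, h.2⟩⟩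
  have hae := AbsCont.ae_deriv_eq hT hi hγ
  have hres : ∀ᵐ t ∂volume.restrict (Icc 0 T), γ' t = deriv γ t := by
    rw [← restrict_Ioc_eq_restrict_Icc, ae_restrict_iff' measurableSet_Ioc]
    filter_upwards [hae] with t ht h using (ht h).symm
  refine ⟨Integrable.congr hi hres, fun t ht => ?_⟩
  rw [hγ t ht]
  congr 1
  refine intervalIntegral.integral_congr_ae ?_
  filter_upwards [hae] with s hs h
  rw [uIoc_of_le ht.1] at h
  exact (hs ⟨h.1, h.2.trans ht.2⟩).symm

theorem AbsCont.continuousOn (hT : 0 ≤ T) (h : AbsCont T γ) : ContinuousOn γ (Icc 0 T) := by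
  obtain ⟨γ', hi, hγ⟩ := h
  have := intervalIntegral.continuousOn_primitive_interval (a := 0) (b := T) (f := γ')
    (μ := volume) (by rwa [uIcc_of_le hT])
  rw [uIcc_of_le hT] at this
  exact (this.const_add (γ 0)).congr hγ

theorem AbsCont.intervalIntegrable_deriv (h : AbsCont T γ) {a b : ℝ} (ha : 0 ≤ a) (hab : a ≤ b)
    (hb : b ≤ T) : IntervalIntegrable (deriv γ) volume a b :=
  ((absCont_iff_deriv (ha.trans (hab.trans hb))).1 h).1.mono_set
    (by rw [uIcc_of_le hab, uIcc_of_le (ha.trans (hab.trans hb))]; exact Icc_subset_Icc ha hb)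

theorem AbsCont.integral_deriv (h : AbsCont T γ) {a b : ℝ} (ha : 0 ≤ a) (hab : a ≤ b)
    (hb : b ≤ T) : ∫ s in a..b, deriv γ s = γ b - γ a := by
  have hT := ha.trans (hab.trans hb)
  have h2 := ((absCont_iff_deriv hT).1 h).2
  rw [h2 a ⟨ha, hab.trans hb⟩, h2 b ⟨ha.trans hab, hb⟩,
    ← intervalIntegral.integral_add_adjacent_intervals
      (h.intervalIntegrable_deriv le_rfl ha (hab.trans hb)) (h.intervalIntegrable_deriv ha hab hb)]
  abel

theorem AbsCont.add_smul_contDiff (hT : 0 ≤ T) (h : AbsCont T γ) {θ : ℝ → ℝ}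
    (hθ : ContDiff ℝ 1 θ) (w : EucSp n) : AbsCont T (fun t => γ t + θ t • w) := by
  have hc : Continuous fun s => deriv θ s • w :=
    (hθ.continuous_deriv le_rfl).smul continuous_const
  refine ⟨fun s => deriv γ s + deriv θ s • w, ?_, fun t ht => ?_⟩
  · rw [← intervalIntegrable_iff_integrableOn_Icc_of_le hT]
    exact (h.intervalIntegrable_deriv le_rfl hT le_rfl).add (hc.intervalIntegrable _ _)
  · rw [intervalIntegral.integral_add (h.intervalIntegrable_deriv le_rfl ht.1 ht.2)
      (hc.intervalIntegrable _ _), h.integral_deriv le_rfl ht.1 ht.2,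
      intervalIntegral.integral_smul_const, intervalIntegral.integral_deriv_eq_sub
        (fun s _ => (hθ.differentiable one_ne_zero).differentiableAt)
        ((hθ.continuous_deriv le_rfl).intervalIntegrable _ _)]
    module

/-- The curve following `γ` up to time `a`, then moving with constant velocity `u`. -/
def straightenAfter (γ : ℝ → EucSp n) (a : ℝ) (u : EucSp n) (t : ℝ) : EucSp n :=
  if t ≤ a then γ t else γ a + (t - a) • u

theorem straightenAfter_of_le {a t : ℝ} (u : EucSp n) (h : t ≤ a) :
    straightenAfter γ a u t = γ t := if_pos h

theorem straightenAfter_of_ge {a t : ℝ} (u : EucSp n) (h : a ≤ t) :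
    straightenAfter γ a u t = γ a + (t - a) • u := by
  rcases h.eq_or_lt with rfl | h
  · simp [straightenAfter]
  · exact if_neg h.not_ge

theorem deriv_straightenAfter_of_lt {a t : ℝ} (u : EucSp n) (h : t < a) :
    deriv (straightenAfter γ a u) t = deriv γ t := by
  refine EventuallyEq.deriv_eq ?_
  filter_upwards [Iio_mem_nhds h] with s hs using straightenAfter_of_le u (le_of_lt hs)

theorem deriv_straightenAfter_of_gt {a t : ℝ} (u : EucSp n) (h : a < t) :
    deriv (straightenAfter γ a u) t = u := by
  have h1 : HasDerivAt (fun s : ℝ => γ a + (s - a) • u) u t := by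
    simpa using (((hasDerivAt_id t).sub_const a).smul_const u).const_add (γ a)
  refine (h1.congr_of_eventuallyEq ?_).deriv
  filter_upwards [Ioi_mem_nhds h] with s hs using straightenAfter_of_ge u (le_of_lt hs)

theorem AbsCont.straightenAfter (h : AbsCont T γ) {a : ℝ} (ha : 0 ≤ a) (haT : a ≤ T)
    (u : EucSp n) : AbsCont T (straightenAfter γ a u) := by
  have hlt : ∀ {t}, t ≤ a → EqOn (deriv γ) (deriv (_root_.straightenAfter γ a u)) (Ioo 0 t) :=
    fun ht s hs => (deriv_straightenAfter_of_lt u (hs.2.trans_le ht)).symm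
  have hgt : ∀ {t}, EqOn (fun _ => u) (deriv (_root_.straightenAfter γ a u)) (Ioo a t) :=
    fun {_} s hs => (deriv_straightenAfter_of_gt u hs.1).symm
  have i1 : ∀ {t}, 0 ≤ t → t ≤ a →
      IntervalIntegrable (deriv (_root_.straightenAfter γ a u)) volume 0 t := fun h0 ht =>
    (h.intervalIntegrable_deriv le_rfl h0 (ht.trans haT)).congr_uIoo
      (by rw [uIoo_of_le h0]; exact hlt ht)
  have i2 : ∀ {t}, a ≤ t →
      IntervalIntegrable (deriv (_root_.straightenAfter γ a u)) volume a t := fun ht =>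
    intervalIntegrable_const.congr_uIoo (by rw [uIoo_of_le ht]; exact hgt)
  refine (absCont_iff_deriv (ha.trans haT)).2 ⟨(i1 ha le_rfl).trans (i2 haT), fun t ht => ?_⟩
  rw [straightenAfter_of_le u ha]
  rcases le_total t a with hta | hta
  · rw [straightenAfter_of_le u hta, ← intervalIntegral.integral_congr_Ioo_of_le ht.1 (hlt hta),
      h.integral_deriv le_rfl ht.1 ht.2]
    abel
  · rw [straightenAfter_of_ge u hta,
      ← intervalIntegral.integral_add_adjacent_intervals (i1 ha le_rfl) (i2 hta),
      ← intervalIntegral.integral_congr_Ioo_of_le ha (hlt le_rfl),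
      ← intervalIntegral.integral_congr_Ioo_of_le hta hgt,
      h.integral_deriv le_rfl ha haT, intervalIntegral.integral_const]
    abel

theorem hasDerivWithinAt_comp_terminal_sub (hT : 0 < T) {v : EucSp n}
    (hv : HasDerivWithinAt γ v (Icc 0 T) T) :
    HasDerivWithinAt (fun h => γ (T - h)) (-v) (Ici 0) 0 := by
  have h1 : HasDerivWithinAt (fun h : ℝ => T - h) (-1) (Icc 0 T) 0 := by
    simpa using ((hasDerivAt_id (0 : ℝ)).const_sub T).hasDerivWithinAt
  have hv' : HasDerivWithinAt γ v (Icc 0 T) (T - 0) := by simpa using hv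
  have h2 := hv'.scomp 0 h1 fun h hh => by
    simp only [mem_Icc] at hh ⊢
    constructor <;> linarith
  have h3 : Icc 0 T ∈ 𝓝[Ici 0] (0 : ℝ) := Icc_mem_nhdsGE hT
  simpa [Function.comp_def] using h2.mono_of_mem_nhdsWithin h3

/-- First-order terminal condition for a Lagrangian minimizer: the terminal velocity minimizes the
Lagrangian tilted by the gradient of the terminal cost. -/
theorem lagrangian_le_of_terminal_deriv (hT : 0 < T)
    {L : ℝ → EucSp n → EucSp n → ℝ} {Q : ℝ → EucSp n → EucSp n} {G : EucSp n → ℝ}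
    {v p : EucSp n} {c : ℝ}
    (hL : ∀ u, ContinuousOn (fun z : ℝ × EucSp n => L z.1 z.2 u) (Icc 0 T ×ˢ univ))
    (hQ : ContinuousOn (fun z : ℝ × EucSp n => Q z.1 z.2) (Icc 0 T ×ˢ univ)) (hc : 0 < c)
    (hconv : ∀ t ∈ Icc 0 T, ∀ x w, L t x v + ⟪Q t x, w⟫ + c / 2 * ‖w‖ ^ 2 ≤ L t x (v + w))
    (hγ : AbsCont T γ) (hint : IntervalIntegrable (fun t => L t (γ t) (deriv γ t)) volume 0 T)
    (hmin : ∀ σ, AbsCont T σ → σ 0 = γ 0 →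
      (∫ t in (0:ℝ)..T, L t (γ t) (deriv γ t)) + G (γ T) ≤
        (∫ t in (0:ℝ)..T, L t (σ t) (deriv σ t)) + G (σ T))
    (hv : HasDerivWithinAt γ v (Icc 0 T) T) (hG : HasGradientAt G p (γ T)) (u : EucSp n) :
    L T (γ T) v ≤ L T (γ T) u + ⟪p, u - v⟫ := by
  have hTm : T ∈ Icc 0 T := right_mem_Icc.2 hT.le
  refine le_of_forall_pos_le_add fun e he => ?_
  obtain ⟨η, hη, rfl⟩ : ∃ η, 0 < η ∧ e = 5 * η := ⟨e / 5, by positivity, by ring⟩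
  -- the data are almost constant near the terminal point
  obtain ⟨r, hr, hloc⟩ : ∃ r > 0, ∀ t ∈ Icc 0 T, dist t T < r → ∀ x, dist x (γ T) < r →
      L T (γ T) v - η < L t x v ∧ ‖Q t x - Q T (γ T)‖ ^ 2 < 2 * c * η ∧
        L t x u < L T (γ T) u + η := by
    have hmem : (T, γ T) ∈ Icc 0 T ×ˢ (univ : Set (EucSp n)) := ⟨hTm, mem_univ _⟩
    have e1 := (hL v _ hmem).eventually (lt_mem_nhds (sub_lt_self _ hη))
    have hQc : ContinuousWithinAt (fun z : ℝ × EucSp n => ‖Q z.1 z.2 - Q T (γ T)‖ ^ 2)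
        (Icc 0 T ×ˢ univ) (T, γ T) := ((hQ _ hmem).sub continuousWithinAt_const).norm.pow 2
    have hQ0 : ‖Q T (γ T) - Q T (γ T)‖ ^ 2 < 2 * c * η := by
      rw [sub_self, norm_zero, zero_pow two_ne_zero]
      positivity
    have e2 := hQc.eventually (gt_mem_nhds hQ0)
    have e3 := (hL u _ hmem).eventually (gt_mem_nhds (lt_add_of_pos_right _ hη))
    obtain ⟨r, hr, hsub⟩ := mem_nhdsWithin_iff.1 (e1.and (e2.and e3))
    refine ⟨r, hr, fun t ht htr x hx => ?_⟩
    exact hsub (show (t, x) ∈ ball (T, γ T) r ∩ _ from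
      ⟨by simp [Prod.dist_eq, htr, hx], ht, mem_univ _⟩)
  obtain ⟨r', hr', hγr⟩ := Metric.continuousWithinAt_iff.1 (hγ.continuousOn hT.le T hTm)
    (r / 2) (by positivity)
  have hd := hasDerivWithinAt_comp_terminal_sub hT hv
  have hd1 : HasDerivWithinAt (fun h => ⟪Q T (γ T), γ T - γ (T - h) - h • v⟫) 0 (Ici 0) 0 := by
    have h1 := (hd.const_sub (γ T)).sub
      ((hasDerivWithinAt_id (0 : ℝ) (Ici 0)).smul_const v)
    have h2 := (hasDerivWithinAt_const (0 : ℝ) (Ici 0) (Q T (γ T))).inner ℝ h1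
    simpa using h2
  have hd2 : HasDerivWithinAt (fun h => G (γ (T - h) + h • u)) ⟪p, u - v⟫ (Ici 0) 0 := by
    have h1 := hd.add ((hasDerivWithinAt_id (0 : ℝ) (Ici 0)).smul_const u)
    have hG' : HasFDerivAt G (InnerProductSpace.toDual ℝ _ p) (γ (T - 0) + (0 : ℝ) • u) := by
      simpa using hG.hasFDerivAt
    have h2 := hG'.comp_hasDerivWithinAt (0 : ℝ) h1
    simpa [Function.comp_def, neg_add_eq_sub] using h2
  have s1 := (hasDerivWithinAt_iff_tendsto_slope' self_notMem_Ioi).1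
    (hd1.mono Ioi_subset_Ici_self)
  have s2 := (hasDerivWithinAt_iff_tendsto_slope' self_notMem_Ioi).1
    (hd2.mono Ioi_subset_Ici_self)
  obtain ⟨h, ⟨hh, hh1, hh2⟩, hs1, hs2⟩ : ∃ h : ℝ,
      (h ∈ Ioo 0 T ∧ h ∈ Ioo 0 (min r r') ∧ h ∈ Ioo 0 (r / (2 * (‖u‖ + 1)))) ∧
      -(η * h) < ⟪Q T (γ T), γ T - γ (T - h) - h • v⟫ ∧
      G (γ (T - h) + h • u) < G (γ T) + (⟪p, u - v⟫ + η) * h := by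
    have a1 := s1.eventually (lt_mem_nhds (neg_neg_of_pos hη))
    have a2 := s2.eventually (gt_mem_nhds (lt_add_of_pos_right _ hη))
    have a3 : ∀ᶠ h in 𝓝[>] (0 : ℝ), h ∈ Ioo 0 T := Ioo_mem_nhdsGT hT
    have a4 : ∀ᶠ h in 𝓝[>] (0 : ℝ), h ∈ Ioo 0 (min r r') := Ioo_mem_nhdsGT (lt_min hr hr')
    have a5 : ∀ᶠ h in 𝓝[>] (0 : ℝ), h ∈ Ioo 0 (r / (2 * (‖u‖ + 1))) :=
      Ioo_mem_nhdsGT (by positivity)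
    obtain ⟨h, b1, b2, b3, b4, b5⟩ := (a1.and (a2.and (a3.and (a4.and a5)))).exists
    refine ⟨h, ⟨b3, b4, b5⟩, ?_, ?_⟩
    · rw [slope_def_field, lt_div_iff₀ (by linarith [b3.1])] at b1
      simpa using b1
    · rw [slope_def_field, div_lt_iff₀ (by linarith [b3.1])] at b2
      simp only [sub_zero, zero_smul, add_zero] at b2
      linarith
  set a := T - h with ha
  have ha0 : 0 ≤ a := by linarith [hh.2]
  have haT : a ≤ T := by linarith [hh.1]
  have hah : T - a = h := by rw [ha]; ring
  have hsubI : Icc a T ⊆ Icc 0 T := Icc_subset_Icc_left ha0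
  have hdist : ∀ t ∈ Icc a T, dist t T < min r r' := fun t ht => by
    rw [Real.dist_eq, abs_sub_comm, abs_of_nonneg (by linarith [ht.2])]
    linarith [ht.1, hh1.2]
  have hγt : ∀ t ∈ Icc a T, dist (γ t) (γ T) < r / 2 := fun t ht =>
    hγr (hsubI ht) ((hdist t ht).trans_le (min_le_right _ _))
  have hσt : ∀ t ∈ Icc a T, dist (straightenAfter γ a u t) (γ T) < r := fun t ht => by
    rw [straightenAfter_of_ge u ht.1]
    have h1 := hγt a (left_mem_Icc.2 haT)
    have h2 : ‖(t - a) • u‖ ≤ r / 2 := by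
      rw [norm_smul, Real.norm_eq_abs, abs_of_nonneg (by linarith [ht.1])]
      have h3 : h * (‖u‖ + 1) < r / 2 := by
        have := (lt_div_iff₀ (by positivity)).1 hh2.2
        linarith
      have h4 : t - a ≤ h := by linarith [ht.2]
      have := mul_le_mul h4 (by linarith : ‖u‖ ≤ ‖u‖ + 1) (norm_nonneg _) hh.1.le
      linarith
    rw [dist_eq_norm] at h1 ⊢
    calc ‖γ a + (t - a) • u - γ T‖ = ‖(γ a - γ T) + (t - a) • u‖ := by congr 1; abel
      _ ≤ ‖γ a - γ T‖ + ‖(t - a) • u‖ := norm_add_le _ _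
      _ < r := by linarith
  have hσ : AbsCont T (straightenAfter γ a u) := hγ.straightenAfter ha0 haT u
  have i1 : IntervalIntegrable (fun t => L t (γ t) (deriv γ t)) volume 0 a :=
    hint.mono_set (by rw [uIcc_of_le ha0, uIcc_of_le hT.le]; exact Icc_subset_Icc_right haT)
  have i2 : IntervalIntegrable (fun t => L t (γ t) (deriv γ t)) volume a T :=
    hint.mono_set (by rw [uIcc_of_le haT, uIcc_of_le hT.le]; exact hsubI)
  have i3 : IntervalIntegrable (fun t => L t (straightenAfter γ a u t) u) volume a T := by
    refine ContinuousOn.intervalIntegrable ?_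
    rw [uIcc_of_le haT]
    exact (hL u).comp (continuousOn_id.prodMk ((hσ.continuousOn hT.le).mono hsubI))
      fun t ht => ⟨hsubI ht, mem_univ _⟩
  have c1 : EqOn (fun t => L t (γ t) (deriv γ t))
      (fun t => L t (straightenAfter γ a u t) (deriv (straightenAfter γ a u) t)) (Ioo 0 a) :=
    fun t ht => by
      simp only
      rw [straightenAfter_of_le u ht.2.le, deriv_straightenAfter_of_lt u ht.2]
  have c2 : EqOn (fun t => L t (straightenAfter γ a u t) u)
      (fun t => L t (straightenAfter γ a u t) (deriv (straightenAfter γ a u) t)) (Ioo a T) :=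
    fun t ht => by
      simp only
      rw [deriv_straightenAfter_of_gt u ht.1]
  have hcmp := hmin _ hσ (straightenAfter_of_le u ha0)
  rw [← intervalIntegral.integral_add_adjacent_intervals i1 i2,
    ← intervalIntegral.integral_add_adjacent_intervals
      (i1.congr_uIoo (by rwa [uIoo_of_le ha0])) (i3.congr_uIoo (by rwa [uIoo_of_le haT])),
    ← intervalIntegral.integral_congr_Ioo_of_le ha0 c1,
    ← intervalIntegral.integral_congr_Ioo_of_le haT c2, straightenAfter_of_ge u haT, hah] at hcmp
  have hup : ∫ t in a..T, L t (straightenAfter γ a u t) u ≤ h * (L T (γ T) u + η) := by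
    have := intervalIntegral.integral_mono_on haT i3 intervalIntegrable_const fun t ht =>
      (hloc t (hsubI ht) ((hdist t ht).trans_le (min_le_left _ _)) _ (hσt t ht)).2.2.le
    rwa [intervalIntegral.integral_const, hah, smul_eq_mul] at this
  have iγ := hγ.intervalIntegrable_deriv ha0 haT le_rfl
  have iv : IntervalIntegrable (fun t => deriv γ t - v) volume a T :=
    iγ.sub intervalIntegrable_const
  have hlow : h * (L T (γ T) v - 2 * η) + ⟪Q T (γ T), γ T - γ a - h • v⟫ ≤
      ∫ t in a..T, L t (γ t) (deriv γ t) := by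
    have iq : IntervalIntegrable (fun t => ⟪Q T (γ T), deriv γ t - v⟫) volume a T :=
      ⟨iv.1.const_inner _, iv.2.const_inner _⟩
    have := intervalIntegral.integral_mono_on haT
      ((intervalIntegrable_const (c := L T (γ T) v - 2 * η)).add iq) i2 fun t ht => by
        obtain ⟨b1, b2, -⟩ := hloc t (hsubI ht) ((hdist t ht).trans_le (min_le_left _ _)) (γ t)
          ((hγt t ht).trans (half_lt_self hr))
        have b3 := hconv t (hsubI ht) (γ t) (deriv γ t - v)
        rw [add_sub_cancel] at b3
        have b4 := abs_le.1 (abs_real_inner_le_norm (Q t (γ t) - Q T (γ T)) (deriv γ t - v))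
        rw [inner_sub_left] at b4
        have b5 : ‖Q t (γ t) - Q T (γ T)‖ * ‖deriv γ t - v‖ ≤
            η + c / 2 * ‖deriv γ t - v‖ ^ 2 := by
          have := sq_nonneg (‖Q t (γ t) - Q T (γ T)‖ - c * ‖deriv γ t - v‖)
          refine le_of_mul_le_mul_left ?_ hc
          nlinarith
        linarith [b4.1]
    rw [intervalIntegral.integral_add intervalIntegrable_const iq,
      intervalIntegral.integral_const, hah, smul_eq_mul] at this
    have e : ∫ t in a..T, ⟪Q T (γ T), deriv γ t - v⟫ = ⟪Q T (γ T), γ T - γ a - h • v⟫ := by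
      have := (innerSL ℝ (Q T (γ T))).intervalIntegral_comp_comm iv
      simp only [innerSL_apply_apply] at this
      rw [this, intervalIntegral.integral_sub iγ intervalIntegrable_const,
        hγ.integral_deriv ha0 haT le_rfl, intervalIntegral.integral_const, hah]
    rwa [e] at this
  refine le_of_mul_le_mul_left ?_ hh.1
  linarith

end Curves

section Penalized

variable {n : ℕ} {Ω : Set (EucSp n)} {T ε δ ρ : ℝ} {f : ℝ → EucSp n → EucSp n → ℝ}
  {g : EucSp n → ℝ} {x : EucSp n} {γ : ℝ → EucSp n}

/-- If the running cost of a penalized minimizer were not integrable on a part of the time interval,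
then changing the curve elsewhere would give other minimizers, passing through any given point. -/
theorem IsPenMin.intervalIntegrable_of_disjoint_ball (hT : 0 < T)
    (hγ : IsPenMin Ω T ε δ f g x γ)
    (hρ : ∀ σ, IsPenMin Ω T ε δ f g x σ → ∀ t ∈ Icc 0 T, dOm Ω (σ t) ≤ ρ)
    (hfar : ∃ z, ρ < dOm Ω z) {a b c r : ℝ} (ha : 0 ≤ a) (hab : a ≤ b) (hb : b ≤ T) (hr : 0 < r)
    (h0 : r ≤ c) (h1 : c ≤ T - r) (hd : ∀ t ∈ Ioo a b, r ≤ dist t c) :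
    IntervalIntegrable (fun t => f t (γ t) (deriv γ t) + (1/ε) * dOm Ω (γ t)) volume a b := by
  by_contra hni
  obtain ⟨z, hz⟩ := hfar
  let θ : ContDiffBump c := ⟨r / 2, r, by positivity, by linarith⟩
  set σ : ℝ → EucSp n := fun t => γ t + θ t • (z - γ c) with hσ
  have hσ_eq : ∀ t, r ≤ dist t c → σ t = γ t := fun t ht => by
    simp [hσ, θ.zero_of_le_dist ht]
  have hσ0 : σ 0 = γ 0 := hσ_eq 0 (by
    rw [dist_comm, Real.dist_eq, sub_zero]; exact h0.trans (le_abs_self c))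
  have hσT : σ T = γ T := hσ_eq T (by
    rw [Real.dist_eq]; exact le_trans (by linarith) (le_abs_self (T - c)))
  have hσc : σ c = z := by
    have : θ c = 1 := θ.one_of_mem_closedBall (mem_closedBall_self θ.rIn_pos.le)
    simp [hσ, this]
  have hsub : uIcc a b ⊆ uIcc 0 T := by
    rw [uIcc_of_le hab, uIcc_of_le hT.le]; exact Icc_subset_Icc ha hb
  have hγni : ¬ IntervalIntegrable (fun t => f t (γ t) (deriv γ t) + (1/ε) * dOm Ω (γ t))
      volume 0 T := fun h => hni (h.mono_set hsub)
  have hσni : ¬ IntervalIntegrable (fun t => f t (σ t) (deriv σ t) + (1/ε) * dOm Ω (σ t))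
      volume 0 T := fun h => hni <| (h.mono_set hsub).congr_uIoo <| by
    rw [uIoo_of_le hab]
    intro t ht
    have he : σ =ᶠ[𝓝 t] γ := by
      filter_upwards [isOpen_Ioo.mem_nhds ht] with s hs using hσ_eq s (hd s hs)
    simp only [he.deriv_eq, he.eq_of_nhds]
  have hcost : costPen Ω T ε δ f g σ = costPen Ω T ε δ f g γ := by
    rw [costPen, costPen, intervalIntegral.integral_undef hγni,
      intervalIntegral.integral_undef hσni, hσT]
  have hσmin : IsPenMin Ω T ε δ f g x σ :=
    ⟨hγ.1.add_smul_contDiff hT.le θ.contDiff _, hσ0.trans hγ.2.1, fun τ hτ hτ0 =>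
      hcost.le.trans (hγ.2.2 τ hτ hτ0)⟩
  have := hρ σ hσmin c ⟨by linarith, by linarith⟩
  rw [hσc] at this
  linarith

theorem IsPenMin.intervalIntegrable (hT : 0 < T) (hγ : IsPenMin Ω T ε δ f g x γ)
    (hρ : ∀ σ, IsPenMin Ω T ε δ f g x σ → ∀ t ∈ Icc 0 T, dOm Ω (σ t) ≤ ρ)
    (hfar : ∃ z, ρ < dOm Ω z) :
    IntervalIntegrable (fun t => f t (γ t) (deriv γ t) + (1/ε) * dOm Ω (γ t)) volume 0 T := by
  refine IntervalIntegrable.trans (b := T / 2)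
    (hγ.intervalIntegrable_of_disjoint_ball hT hρ hfar (c := 3 * T / 4) (r := T / 4) le_rfl
      (by linarith) (by linarith) (by linarith) (by linarith) (by linarith) fun t ht => ?_)
    (hγ.intervalIntegrable_of_disjoint_ball hT hρ hfar (c := T / 4) (r := T / 4) (by linarith)
      (by linarith) le_rfl (by linarith) (by linarith) (by linarith) fun t ht => ?_)
  · rw [dist_comm, Real.dist_eq]
    exact le_trans (by linarith [ht.2]) (le_abs_self _)
  · rw [Real.dist_eq]
    exact le_trans (by linarith [ht.1]) (le_abs_self _)

end Penalized

/-- If `v₀` minimizes `φ + ⟪p, ·⟫` and `‖v₀‖ ≤ N`, then tilting further by `ν / δ`, with `ν` a unit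
vector and `δ` small, moves the minimizer into the half-space `⟪·, ν⟫ ≤ 0`. -/
theorem inner_nonpos_of_tilted_minimizer {E : Type*} [NormedAddCommGroup E] [InnerProductSpace ℝ E]
    {φ : E → ℝ} {μ δ N : ℝ} (hμ : 0 < μ) (hδ : 0 < δ) (hδN : δ * (2 * μ * N) ≤ 1) {p ν v v₀ : E}
    (hν : ‖ν‖ = 1) (hv₀N : ‖v₀‖ ≤ N) (hv₀ : ∀ w, φ v₀ + ⟪p, v₀⟫ ≤ φ w + ⟪p, w⟫)
    (hup : ∀ w, φ (v₀ + w) ≤ φ v₀ - ⟪p, w⟫ + μ / 2 * ‖w‖ ^ 2)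
    (hv : ∀ u, φ v ≤ φ u + ⟪(1 / δ) • ν + p, u - v⟫) : ⟪v, ν⟫ ≤ 0 := by
  have h1 := hv (v₀ + (-(1 / (μ * δ))) • ν)
  have h2 := hup ((-(1 / (μ * δ))) • ν)
  have h3 := hv₀ v
  have h4 : ⟪ν, v₀⟫ ≤ N := by
    have := real_inner_le_norm ν v₀
    rw [hν, one_mul] at this
    exact this.trans hv₀N
  rw [norm_smul, hν, mul_one, norm_neg, Real.norm_eq_abs, sq_abs] at h2
  simp only [inner_add_left, inner_sub_right, inner_add_right, real_inner_smul_left,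
    real_inner_smul_right, real_inner_self_eq_norm_sq, hν] at h1 h2
  rw [real_inner_comm]
  have h5 : ⟪ν, v⟫ / δ ≤ N / δ - 1 / (2 * μ * δ ^ 2) := by
    have e1 : μ / 2 * (1 / (μ * δ)) ^ 2 = 1 / (2 * μ * δ ^ 2) := by field_simp
    have e2 : 1 / δ * (-(1 / (μ * δ)) * 1 ^ 2) = -(2 * (1 / (2 * μ * δ ^ 2))) := by field_simp
    have e3 : ⟪ν, v₀⟫ / δ ≤ N / δ := by gcongr
    have e4 : 1 / δ * ⟪ν, v⟫ = ⟪ν, v⟫ / δ := by ring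
    have e5 : 1 / δ * ⟪ν, v₀⟫ = ⟪ν, v₀⟫ / δ := by ring
    linarith
  have h6 : N / δ - 1 / (2 * μ * δ ^ 2) ≤ 0 := by
    rw [sub_nonpos, div_le_div_iff₀ hδ (by positivity)]
    nlinarith
  have h7 := h5.trans h6
  rw [div_le_iff₀ hδ] at h7
  linarith

/-- Up to sign, `DpH f t y p` is the minimizer of the tilted Lagrangian `f t y + ⟪p, ·⟫`. -/
theorem FAssumptions.exists_minimizer_norm_eq_DpH {n : ℕ} {T : ℝ} {f : ℝ → EucSp n → EucSp n → ℝ}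
    {Dxf Dvf : ℝ → EucSp n → EucSp n → EucSp n}
    {Dvvf Dvxf : ℝ → EucSp n → EucSp n → (EucSp n →L[ℝ] EucSp n)} {M μ κ : ℝ}
    (hf : FAssumptions T (univ : Set (EucSp n)) f Dxf Dvf Dvvf Dvxf M μ κ) {t : ℝ}
    (ht : t ∈ Icc 0 T) (y p : EucSp n) :
    ∃ v₀, ‖v₀‖ = ‖DpH f t y p‖ ∧ (∀ w, f t y v₀ + ⟪p, v₀⟫ ≤ f t y w + ⟪p, w⟫) ∧
      ∀ w, f t y (v₀ + w) ≤ f t y v₀ - ⟪p, w⟫ + μ / 2 * ‖w‖ ^ 2 := by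
  have hμ : 0 < μ := zero_lt_one.trans_le hf.μge
  have hG := hf.hDvf t ht y (mem_univ y)
  have hB := hf.hDvvf t ht y (mem_univ y)
  have hlow := quadratic_lower_bound hG hB (hf.vvLower t ht y (mem_univ y))
  have hup := quadratic_upper_bound hG hB (hf.vvUpper t ht y (mem_univ y))
  obtain ⟨v₀, hv₀⟩ := exists_forall_add_inner_le hG (one_div_pos.2 hμ)
    (fun w => by simpa using hlow 0 w) p
  have hgrad := gradient_eq_neg_of_forall_add_inner_le hG hv₀
  refine ⟨v₀, ?_, hv₀, fun w => ?_⟩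
  · have := (hasGradientAt_iSup_neg_inner_sub (φ := f t y) (one_div_pos.2 hμ) (p := p) (v := v₀)
      fun w => by
        have := hlow v₀ (w - v₀)
        rw [hgrad, inner_neg_left, add_sub_cancel] at this
        linarith).gradient
    rw [DpH, show (fun q => ham f t y q) = fun q => ⨆ w, (-⟪q, w⟫ - f t y w) from rfl, this,
      norm_neg]
  · have := hup v₀ w
    rw [hgrad, inner_neg_left] at this
    linarith

/-- Lemma 3.6: if the terminal point of a penalized minimizer lies
outside `cl Ω`, the map `t ↦ b_Ω(γ(t))` has nonpositive slope at `t = T`. -/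
theorem terminal_inward_slope {n : ℕ} (Ω : Set (EucSp n)) (T ρ₀ : ℝ)
    (hT : 0 < T) (hΩo : IsOpen Ω) (hΩb : Bornology.IsBounded Ω) (hΩne : Ω.Nonempty)
    (hC2 : C2Bdry Ω ρ₀)
    (f : ℝ → EucSp n → EucSp n → ℝ)
    (Dxf Dvf : ℝ → EucSp n → EucSp n → EucSp n)
    (Dvvf Dvxf : ℝ → EucSp n → EucSp n → (EucSp n →L[ℝ] EucSp n))
    (M μ κ : ℝ)
    (hf : FAssumptions T (univ : Set (EucSp n)) f Dxf Dvf Dvvf Dvxf M μ κ)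
    (g : EucSp n → ℝ) (Dg : EucSp n → EucSp n) (Cg : ℝ)
    (hg : GAssumptions (univ : Set (EucSp n)) g Dg Cg)
    (N : ℝ) (hN : N = sSup (range (fun y => ‖DpH f T y (Dg y)‖)))
    (δ : ℝ) (hδ : δ = min (1 / (2 * μ * N)) 1)
    (ε₀ : ℝ) (hε₀ : 0 < ε₀)
    -- `ε₀ = ε(ρ₀)`: minimizers with parameters in `(0,ε₀] × (0,1]` stay `ρ₀`-close to `Ω`
    (hε₀prop : ∀ ε ∈ Ioc (0:ℝ) ε₀, ∀ δ' ∈ Ioc (0:ℝ) 1, ∀ x ∈ closure Ω,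
      ∀ γ : ℝ → EucSp n, IsPenMin Ω T ε δ' f g x γ →
        ∀ t ∈ Icc 0 T, dOm Ω (γ t) ≤ ρ₀) :
    ∀ δ₁ ∈ Ioc (0:ℝ) δ, ∀ ε ∈ Ioc (0:ℝ) ε₀, ∀ x ∈ closure Ω,
      ∀ γ : ℝ → EucSp n, IsPenMin Ω T ε δ₁ f g x γ →
        γ T ∉ closure Ω →
        ∀ γd : EucSp n, HasDerivWithinAt γ γd (Icc 0 T) T →
          ⟪γd, DbOm Ω (γ T)⟫ ≤ 0 := by
  intro δ₁ hδ₁ ε hε x hx γ hγ hγT γd hγd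
  have hμ : 0 < μ := zero_lt_one.trans_le hf.μge
  have hTm : T ∈ Icc 0 T := right_mem_Icc.2 hT.le
  by_cases hdiff : DifferentiableAt ℝ (bOm Ω) (γ T)
  swap
  · rw [DbOm, gradient_eq_zero_of_not_differentiableAt hdiff, inner_zero_right]
  have hν : HasGradientAt (dOm Ω) (DbOm Ω (γ T)) (γ T) :=
    hdiff.hasGradientAt.congr_of_eventuallyEq (bOm_eventuallyEq_dOm hγT).symm
  have hδ₁1 : δ₁ ∈ Ioc (0 : ℝ) 1 := ⟨hδ₁.1, hδ₁.2.trans (hδ.trans_le (min_le_right _ _))⟩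
  have hN0 : 0 < N := by
    have h1 : 0 < 1 / (2 * μ * N) :=
      hδ₁.1.trans_le (hδ₁.2.trans (hδ.trans_le (min_le_left _ _)))
    exact (mul_pos_iff_of_pos_left (by positivity)).1 (one_div_pos.1 h1)
  have hδN : δ₁ * (2 * μ * N) ≤ 1 := by
    rw [← le_div_iff₀ (by positivity)]
    exact hδ₁.2.trans (hδ.trans_le (min_le_left _ _))
  have hNy : ‖DpH f T (γ T) (Dg (γ T))‖ ≤ N := by
    have hbdd : BddAbove (range fun y => ‖DpH f T y (Dg y)‖) := by
      by_contra h
      rw [Real.sSup_of_not_bddAbove h] at hN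
      exact hN0.ne' hN
    rw [hN]
    exact le_csSup hbdd (mem_range_self (γ T))
  have : Nontrivial (EucSp n) := by
    obtain ⟨z, hz⟩ := hΩne
    exact ⟨γ T, z, fun h => hγT (h ▸ subset_closure hz)⟩
  have hint := hγ.intervalIntegrable hT (hε₀prop ε hε δ₁ hδ₁1 x hx) (exists_lt_dOm hΩb hΩne ρ₀)
  have hdOm : Continuous (dOm Ω) := continuous_infDist_pt _
  have hG : HasGradientAt (fun y => (1 / δ₁) * dOm Ω y + g y)
      ((1 / δ₁) • DbOm Ω (γ T) + Dg (γ T)) (γ T) := by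
    rw [hasGradientAt_iff_hasFDerivAt, map_add, map_smul]
    exact (hν.hasFDerivAt.const_mul (1 / δ₁)).add (hg.grad _ (mem_univ _)).hasFDerivAt
  have hmain := lagrangian_le_of_terminal_deriv hT
    (L := fun t y v => f t y v + (1 / ε) * dOm Ω y) (Q := fun t y => Dvf t y γd)
    (fun u => (hf.fCont.comp (f := fun z : ℝ × EucSp n => (z.1, z.2, u)) (by fun_prop)
      fun z hz => ⟨hz.1, mem_univ _, mem_univ _⟩).add
      (continuous_const.mul (hdOm.comp continuous_snd)).continuousOn)
    (hf.DvfCont.comp (f := fun z : ℝ × EucSp n => (z.1, z.2, γd)) (by fun_prop)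
      fun z hz => ⟨hz.1, mem_univ _, mem_univ _⟩)
    (one_div_pos.2 hμ)
    (fun t ht y w => by
      have := quadratic_lower_bound (hf.hDvf t ht y (mem_univ y)) (hf.hDvvf t ht y (mem_univ y))
        (hf.vvLower t ht y (mem_univ y)) γd w
      linarith)
    hγ.1 hint
    (fun σ hσ hσ0 => by
      have := hγ.2.2 σ hσ (hσ0.trans hγ.2.1)
      simp only [costPen] at this
      linarith)
    hγd hG
  obtain ⟨v₀, hv₀N, hv₀, hup⟩ := hf.exists_minimizer_norm_eq_DpH hTm (γ T) (Dg (γ T))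
  exact inner_nonpos_of_tilted_minimizer hμ hδ₁.1 hδN (norm_DbOm_eq_one hΩne hγT hν)
    (hv₀N.trans_le hNy) hv₀ hup fun u => by linarith [hmain u]

end
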